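/- arXiv:1706.06231 — 3 statements merged into one kernel-verified Lean document; each statement's English description precedes it below -/
import Mathlib

section
/- The number of permutations of {1,...,n} avoiding the pattern 312 with exactly k descents is the Narayana number N(n,k) = (1/n) * C(n,k) * C(n,k+1). -/
def des {n : ℕ} (σ : Equiv.Perm (Fin n)) : ℕ :=
  (Finset.univ.filter (fun i : Fin n =>
    ∃ h : (i : ℕ) + 1 < n, σ ⟨(i : ℕ) + 1, h⟩ < σ i)).card

/-- `σ` avoids the classical pattern `312`: no indices `i < j < k` with `a_j < a_k < a_i`. -/
def avoids312 {n : ℕ} (σ : Equiv.Perm (Fin n)) : Prop :=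
  ¬ ∃ i j k : Fin n, i < j ∧ j < k ∧ σ j < σ k ∧ σ k < σ i

open Finset

/-- If a permutation of a finite type maps the set `p` into itself, then so does its inverse. -/
lemma Equiv.Perm.of_apply_of_mapsTo {α : Type*} [Finite α] (σ : Equiv.Perm α) {p : α → Prop}
    (h : ∀ i, p i → p (σ i)) {i : α} (hi : p (σ i)) : p i := by
  have := Equiv.Perm.perm_symm_mapsTo_of_mapsTo σ (s := {i | p i}) h hi
  simpa using this

/-- The permutation whose last entry is `c` and whose other entries are order isomorphic to `τ`. -/
def appendLast {n : ℕ} (τ : Equiv.Perm (Fin n)) (c : Fin (n + 1)) : Equiv.Perm (Fin (n + 1)) :=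
  (finSuccEquivLast.trans (Equiv.optionCongr τ)).trans (finSuccEquiv' c).symm

@[simp]
lemma appendLast_last {n : ℕ} (τ : Equiv.Perm (Fin n)) (c : Fin (n + 1)) :
    appendLast τ c (Fin.last n) = c := by
  simp [appendLast]

@[simp]
lemma appendLast_castSucc {n : ℕ} (τ : Equiv.Perm (Fin n)) (c : Fin (n + 1)) (i : Fin n) :
    appendLast τ c i.castSucc = c.succAbove (τ i) := by
  simp [appendLast]

lemma appendLast_injective {n : ℕ} :
    Function.Injective fun x : Equiv.Perm (Fin n) × Fin (n + 1) => appendLast x.1 x.2 := by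
  rintro ⟨τ, c⟩ ⟨τ', c'⟩ h
  have hc : c = c' := by simpa using DFunLike.congr_fun h (Fin.last n)
  subst hc
  refine Prod.ext (Equiv.ext fun i => ?_) rfl
  simpa using DFunLike.congr_fun h i.castSucc

lemma exists_appendLast {n : ℕ} (σ : Equiv.Perm (Fin (n + 1))) :
    ∃ τ c, appendLast τ c = σ := by
  have h := (Fintype.bijective_iff_injective_and_card _).2
    ⟨appendLast_injective (n := n), by
      simp [Fintype.card_perm, Nat.factorial_succ, mul_comm]⟩
  obtain ⟨⟨τ, c⟩, h⟩ := h.2 σ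
  exact ⟨τ, c, h⟩

/-- The cut points `c` of `τ`: those for which `τ` preserves the set of the first `c` elements. -/
def cuts {n : ℕ} (τ : Equiv.Perm (Fin n)) : Finset (Fin (n + 1)) :=
  {c | ∀ i : Fin n, (i : ℕ) < c → (τ i : ℕ) < c}

lemma mem_cuts {n : ℕ} {τ : Equiv.Perm (Fin n)} {c : Fin (n + 1)} :
    c ∈ cuts τ ↔ ∀ i : Fin n, (i : ℕ) < c → (τ i : ℕ) < c := by
  simp [cuts]

lemma zero_mem_cuts {n : ℕ} (τ : Equiv.Perm (Fin n)) : 0 ∈ cuts τ := by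
  simp [mem_cuts]

lemma last_mem_cuts {n : ℕ} (τ : Equiv.Perm (Fin n)) : Fin.last n ∈ cuts τ := by
  simp [mem_cuts]

lemma lt_of_mem_cuts {n : ℕ} {τ : Equiv.Perm (Fin n)} {c : Fin (n + 1)} (hc : c ∈ cuts τ)
    {i : Fin n} (hi : (τ i : ℕ) < c) : (i : ℕ) < c :=
  τ.of_apply_of_mapsTo (p := fun i => (i : ℕ) < c) (mem_cuts.1 hc) hi

lemma val_succAbove {n : ℕ} (c : Fin (n + 1)) (i : Fin n) :
    (c.succAbove i : ℕ) = if (i : ℕ) < c then (i : ℕ) else i + 1 := by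
  simp only [Fin.succAbove, Fin.lt_def, Fin.val_castSucc]
  split_ifs <;> rfl

lemma avoids312_appendLast {n : ℕ} (τ : Equiv.Perm (Fin n)) (c : Fin (n + 1)) :
    avoids312 (appendLast τ c) ↔ avoids312 τ ∧ c ∈ cuts τ := by
  constructor
  · intro h
    refine ⟨?_, ?_⟩
    · rintro ⟨i, j, k, hij, hjk, h₁, h₂⟩
      exact h ⟨i.castSucc, j.castSucc, k.castSucc, by simpa, by simpa, by simpa, by simpa⟩
    · rw [mem_cuts]
      intro i hi
      by_contra hτ
      have hmaps : ∀ j : Fin n, (c : ℕ) ≤ j → (c : ℕ) ≤ τ j := by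
        intro j hj
        by_contra hlt
        refine h ⟨i.castSucc, j.castSucc, Fin.last n, ?_, Fin.castSucc_lt_last j, ?_, ?_⟩
        · simp only [Fin.lt_def, Fin.val_castSucc]; omega
        · simp only [appendLast_castSucc, appendLast_last, Fin.lt_def, val_succAbove]
          split_ifs <;> omega
        · simp only [appendLast_castSucc, appendLast_last, Fin.lt_def, val_succAbove]
          split_ifs; omega
      have := τ.of_apply_of_mapsTo (p := fun j => (c : ℕ) ≤ j) hmaps (i := i) (by omega)
      omega
  · rintro ⟨h, hc⟩ ⟨i, j, k, hij, hjk, h₁, h₂⟩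
    obtain ⟨i, rfl⟩ := Fin.exists_castSucc_eq.2 (hij.trans_le (Fin.le_last j)).ne
    obtain ⟨j, rfl⟩ := Fin.exists_castSucc_eq.2 (hjk.trans_le (Fin.le_last k)).ne
    induction k using Fin.lastCases with
    | cast k => exact h ⟨i, j, k, by simpa using hij, by simpa using hjk, by simpa using h₁,
        by simpa using h₂⟩
    | last =>
      simp only [appendLast_castSucc, appendLast_last, Fin.lt_def, val_succAbove,
        Fin.val_castSucc] at h₁ h₂ hij
      have hj : (τ j : ℕ) < c := by split_ifs at h₁ <;> omega
      have hi : ¬ (τ i : ℕ) < c := by split_ifs at h₂ <;> omega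
      have := lt_of_mem_cuts hc hj
      exact hi (mem_cuts.1 hc i (by omega))

lemma cuts_appendLast {n : ℕ} (τ : Equiv.Perm (Fin n)) (c : Fin (n + 1)) :
    cuts (appendLast τ c) =
      insert (Fin.last (n + 1)) (({d ∈ cuts τ | d ≤ c} : Finset _).map Fin.castSuccEmb) := by
  ext d
  induction d using Fin.lastCases with
  | last => simp [last_mem_cuts]
  | cast d =>
    have hd : d.castSucc ∈ insert (Fin.last (n + 1))
        (({d ∈ cuts τ | d ≤ c} : Finset _).map Fin.castSuccEmb) ↔ d ∈ cuts τ ∧ d ≤ c := by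
      simp [Fin.castSucc_ne_last]
    rw [hd]
    constructor
    · intro h
      have hdc : d ≤ c := by
        by_contra hlt
        have := lt_of_mem_cuts h (i := Fin.last n) (by rw [appendLast_last]; exact not_le.1 hlt)
        simp only [Fin.val_last, Fin.val_castSucc] at this
        omega
      refine ⟨mem_cuts.2 fun i hi => ?_, hdc⟩
      have := mem_cuts.1 h i.castSucc (by simpa using hi)
      simp only [appendLast_castSucc, val_succAbove, Fin.val_castSucc] at this
      split_ifs at this <;> omega
    · rintro ⟨h, hdc⟩
      refine mem_cuts.2 fun i hi => ?_
      rw [Fin.le_def] at hdc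
      induction i using Fin.lastCases with
      | last => simp only [Fin.val_last, Fin.val_castSucc] at hi; omega
      | cast i =>
        have := mem_cuts.1 h i (by simpa using hi)
        simp only [appendLast_castSucc, val_succAbove, Fin.val_castSucc]
        split_ifs <;> omega

lemma card_cuts_appendLast {n : ℕ} (τ : Equiv.Perm (Fin n)) (c : Fin (n + 1)) :
    #(cuts (appendLast τ c)) = #{d ∈ cuts τ | d ≤ c} + 1 := by
  rw [cuts_appendLast, card_insert_of_notMem, card_map]
  simp [Fin.castSucc_ne_last]

lemma des_appendLast {n : ℕ} (τ : Equiv.Perm (Fin (n + 1))) (c : Fin (n + 1 + 1)) :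
    des (appendLast τ c) = des τ + if (c : ℕ) ≤ τ (Fin.last n) then 1 else 0 := by
  simp only [des, card_filter, Fin.sum_univ_castSucc (n := n + 1),
    Fin.sum_univ_castSucc (n := n)]
  have hstep (i : Fin n) (h : (i.castSucc.castSucc : ℕ) + 1 < n + 1 + 1) :
      (⟨(i.castSucc.castSucc : ℕ) + 1, h⟩ : Fin (n + 2)) = i.succ.castSucc := rfl
  have hstep' (i : Fin n) (h : (i.castSucc : ℕ) + 1 < n + 1) :
      (⟨(i.castSucc : ℕ) + 1, h⟩ : Fin (n + 1)) = i.succ := rfl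
  have hlast (h : ((Fin.last n).castSucc : ℕ) + 1 < n + 1 + 1) :
      (⟨((Fin.last n).castSucc : ℕ) + 1, h⟩ : Fin (n + 2)) = Fin.last (n + 1) := rfl
  simp only [hstep, hstep', hlast, appendLast_castSucc, appendLast_last,
    Fin.succAbove_lt_succAbove_iff]
  have hiff : c < c.succAbove (τ (Fin.last n)) ↔ (c : ℕ) ≤ τ (Fin.last n) := by
    simp only [Fin.lt_def, val_succAbove]
    split_ifs <;> omega
  simp [hiff]

lemma le_apply_last_iff_of_mem_cuts {n : ℕ} {τ : Equiv.Perm (Fin (n + 1))} {c : Fin (n + 1 + 1)}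
    (hc : c ∈ cuts τ) : (c : ℕ) ≤ τ (Fin.last n) ↔ c ≠ Fin.last (n + 1) := by
  constructor
  · rintro h rfl
    simp only [Fin.val_last] at h
    omega
  · intro h
    by_contra hlt
    have := lt_of_mem_cuts hc (not_le.1 hlt)
    apply h
    ext
    simp only [Fin.val_last] at this ⊢
    omega

/-- A positive rank at most the size of a finite set is attained by some element. -/
lemma Finset.exists_card_filter_le_eq {α : Type*} [LinearOrder α] (A : Finset α) {s : ℕ}
    (hs : 1 ≤ s) (hsA : s ≤ #A) : ∃ c ∈ A, #{d ∈ A | d ≤ c} = s := by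
  induction A using Finset.induction_on_max with
  | empty => simp at hsA; omega
  | insert a A ha ih =>
    have hna : a ∉ A := fun h => (ha a h).false
    rw [card_insert_of_notMem hna] at hsA
    rcases Nat.lt_or_ge #A s with h | h
    · refine ⟨a, mem_insert_self a A, ?_⟩
      rw [filter_true_of_mem, card_insert_of_notMem hna]
      · omega
      · intro x hx
        rcases mem_insert.1 hx with rfl | hx
        exacts [le_rfl, (ha x hx).le]
    · obtain ⟨c, hc, h⟩ := ih h
      refine ⟨c, mem_insert_of_mem hc, ?_⟩
      rw [filter_insert, if_neg (ha c hc).not_ge, h]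

lemma Finset.card_filter_le_injOn {α : Type*} [LinearOrder α] (A : Finset α) :
    Set.InjOn (fun c => #{d ∈ A | d ≤ c}) A := by
  have key : ∀ c ∈ A, ∀ c' ∈ A, c < c' → #{d ∈ A | d ≤ c} < #{d ∈ A | d ≤ c'} := by
    intro c _ c' hc' hlt
    refine card_lt_card ⟨fun x hx => ?_, fun h => ?_⟩
    · simp only [mem_filter] at hx ⊢
      exact ⟨hx.1, hx.2.trans hlt.le⟩
    · have := h (mem_filter.2 ⟨hc', le_rfl⟩)
      simp only [mem_filter] at this
      exact this.2.not_gt hlt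
  intro c hc c' hc' h
  rcases lt_trichotomy c c' with hlt | heq | hlt
  · exact absurd h (key c hc c' hc' hlt).ne
  · exact heq
  · exact absurd h (key c' hc' c hc hlt).ne'

lemma card_filter_le_eq_card_cuts_iff {n : ℕ} {τ : Equiv.Perm (Fin n)} {c : Fin (n + 1)}
    (hc : c ∈ cuts τ) : #{d ∈ cuts τ | d ≤ c} = #(cuts τ) ↔ c = Fin.last n := by
  have hlast : #{d ∈ cuts τ | d ≤ Fin.last n} = #(cuts τ) := by simp [Fin.le_last]
  rw [← hlast]
  exact (card_filter_le_injOn _).eq_iff hc (last_mem_cuts τ)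

lemma des_appendLast_of_mem_cuts {n : ℕ} {τ : Equiv.Perm (Fin (n + 1))} {c : Fin (n + 1 + 1)}
    (hc : c ∈ cuts τ) : des (appendLast τ c) =
      des τ + if #{d ∈ cuts τ | d ≤ c} < #(cuts τ) then 1 else 0 := by
  rw [des_appendLast]
  congr 2
  rw [le_apply_last_iff_of_mem_cuts hc, (card_filter_le _ _).lt_iff_ne, ne_eq, ne_eq,
    card_filter_le_eq_card_cuts_iff hc]

open Classical in
/-- The number of `312`-avoiding permutations of `Fin n` with `a` descents and more than `s`
cut points. -/
noncomputable def numAvoiding (n a s : ℕ) : ℕ :=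
  #{σ : Equiv.Perm (Fin n) | avoids312 σ ∧ des σ = a ∧ s < #(cuts σ)}

open Classical in
lemma card_avoids312_card_cuts_eq (n a s : ℕ) (hs : 1 ≤ s) :
    #{σ : Equiv.Perm (Fin (n + 2)) | avoids312 σ ∧ des σ = a ∧ #(cuts σ) = s + 1} =
      #{τ : Equiv.Perm (Fin (n + 1)) | avoids312 τ ∧
        ((des τ + 1 = a ∧ s < #(cuts τ)) ∨ (des τ = a ∧ #(cuts τ) = s))} := by
  have hex (τ : Equiv.Perm (Fin (n + 1))) (hτ : s ≤ #(cuts τ)) :=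
    (cuts τ).exists_card_filter_le_eq hs hτ
  symm
  refine card_bij (fun τ hτ => appendLast τ (hex τ ?_).choose) ?_ ?_ ?_
  · simp only [mem_filter_univ] at hτ
    omega
  · intro τ hτ
    simp only [mem_filter_univ] at hτ ⊢
    obtain ⟨hc, hrank⟩ := (hex τ (by omega)).choose_spec
    rw [avoids312_appendLast, card_cuts_appendLast, des_appendLast_of_mem_cuts hc, hrank]
    refine ⟨⟨hτ.1, hc⟩, ?_, rfl⟩
    split_ifs <;> omega
  · intro τ _ τ' _ h
    exact congrArg Prod.fst (@appendLast_injective _ (τ, _) (τ', _) h)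
  · intro σ hσ
    obtain ⟨τ, c, rfl⟩ := exists_appendLast σ
    simp only [mem_filter_univ, avoids312_appendLast, card_cuts_appendLast] at hσ
    obtain ⟨⟨hav, hc⟩, hdes, hcard⟩ := hσ
    rw [des_appendLast_of_mem_cuts hc] at hdes
    have hle : #{d ∈ cuts τ | d ≤ c} ≤ #(cuts τ) := card_filter_le _ _
    have hτ : s ≤ #(cuts τ) := by omega
    refine ⟨τ, ?_, ?_⟩
    · simp only [mem_filter_univ]
      refine ⟨hav, ?_⟩
      split_ifs at hdes <;> omega
    · obtain ⟨hc', hrank⟩ := (hex τ hτ).choose_spec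
      congr 1
      exact card_filter_le_injOn _ hc' hc (by simp only [hrank]; omega)

open Classical in
lemma numAvoiding_eq_add (n a s : ℕ) :
    numAvoiding n a s = numAvoiding n a (s + 1) +
      #{σ : Equiv.Perm (Fin n) | avoids312 σ ∧ des σ = a ∧ #(cuts σ) = s + 1} := by
  rw [numAvoiding, numAvoiding, ← card_union_of_disjoint]
  · congr 1
    ext σ
    simp only [mem_filter_univ, mem_union]
    grind
  · rw [disjoint_filter]
    grind

lemma numAvoiding_zero_descents_rec (n s : ℕ) :
    numAvoiding (n + 2) 0 (s + 1) + numAvoiding (n + 1) 0 (s + 1) =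
      numAvoiding (n + 2) 0 (s + 2) + numAvoiding (n + 1) 0 s := by
  classical
  rw [numAvoiding_eq_add (n + 2), card_avoids312_card_cuts_eq n 0 (s + 1) (by omega),
    numAvoiding_eq_add (n + 1) 0 s]
  simp only [Nat.add_one_ne_zero, false_and, false_or]
  ring

lemma numAvoiding_rec (n a s : ℕ) :
    numAvoiding (n + 2) (a + 1) (s + 1) + numAvoiding (n + 1) (a + 1) (s + 1) =
      numAvoiding (n + 2) (a + 1) (s + 2) + numAvoiding (n + 1) (a + 1) s +
        numAvoiding (n + 1) a (s + 1) := by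
  classical
  have hsplit : #{τ : Equiv.Perm (Fin (n + 1)) | avoids312 τ ∧
      ((des τ + 1 = a + 1 ∧ s + 1 < #(cuts τ)) ∨ (des τ = a + 1 ∧ #(cuts τ) = s + 1))} =
      numAvoiding (n + 1) a (s + 1) +
      #{τ : Equiv.Perm (Fin (n + 1)) | avoids312 τ ∧ des τ = a + 1 ∧ #(cuts τ) = s + 1} := by
    rw [numAvoiding, ← card_union_of_disjoint]
    · congr 1
      ext σ
      simp only [mem_filter_univ, mem_union]
      grind
    · rw [disjoint_filter]
      grind
  rw [numAvoiding_eq_add (n + 2), card_avoids312_card_cuts_eq n (a + 1) (s + 1) (by omega),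
    hsplit, numAvoiding_eq_add (n + 1) (a + 1) s]
  ring

lemma two_le_card_cuts {n : ℕ} (τ : Equiv.Perm (Fin (n + 1))) : 2 ≤ #(cuts τ) := by
  rw [← Nat.lt_iff_add_one_le, one_lt_card]
  exact ⟨0, zero_mem_cuts τ, Fin.last _, last_mem_cuts τ, by simp [Fin.ext_iff]⟩

lemma numAvoiding_zero (n a : ℕ) : numAvoiding (n + 1) a 0 = numAvoiding (n + 1) a 1 := by
  classical
  rw [numAvoiding, numAvoiding]
  congr! 3 with σ
  have := two_le_card_cuts σ
  omega

lemma numAvoiding_eq_zero {n s : ℕ} (a : ℕ) (h : n < s) : numAvoiding n a s = 0 := by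
  classical
  rw [numAvoiding, card_eq_zero, filter_eq_empty_iff]
  rintro σ - ⟨-, -, hs⟩
  have := card_le_univ (cuts σ)
  rw [Fintype.card_fin] at this
  omega

lemma numAvoiding_one (a : ℕ) : numAvoiding 1 a 1 = if a = 0 then 1 else 0 := by
  classical
  have hav (σ : Equiv.Perm (Fin 1)) : avoids312 σ := by
    rintro ⟨i, j, k, hij, -⟩
    omega
  have hdes (σ : Equiv.Perm (Fin 1)) : des σ = 0 := by
    rw [des, card_eq_zero, filter_eq_empty_iff]
    rintro i - ⟨h, -⟩
    omega
  have hcuts (σ : Equiv.Perm (Fin 1)) : 1 < #(cuts σ) := two_le_card_cuts σ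
  rw [numAvoiding]
  by_cases h : a = 0
  · simp [hav, hdes, hcuts, h]
  · simp [hav, hdes, hcuts, h, Ne.symm h]

/-- The closed form of `numAvoiding (t + u + 1) a (t + 1)`. -/
def avoidingFormula (t u a : ℕ) : ℚ :=
  u.choose a * (t + u + 1).choose a * (t + u + 1 + t * a) / ((a + 1) * (t + u + 1))

lemma avoidingFormula_zero (t u : ℕ) : avoidingFormula t u 0 = 1 := by
  have : (t + u + 1 : ℚ) ≠ 0 := by positivity
  simp [avoidingFormula, this]

lemma avoidingFormula_zero_succ (t a : ℕ) : avoidingFormula t 0 (a + 1) = 0 := by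
  simp [avoidingFormula]

lemma cast_choose_succ_right (n a : ℕ) :
    (n.choose (a + 1) : ℚ) = n.choose a * (n - a) / (a + 1) := by
  have h : (a + 1 : ℚ) ≠ 0 := by positivity
  rw [eq_div_iff h]
  rcases le_or_gt a n with ha | ha
  · rw [← Nat.cast_sub ha]
    exact_mod_cast Nat.choose_succ_right_eq n a
  · simp [Nat.choose_eq_zero_of_lt ha, Nat.choose_eq_zero_of_lt (ha.trans (Nat.lt_succ_self a))]

lemma cast_choose_succ_succ (n a : ℕ) :
    ((n + 1).choose (a + 1) : ℚ) = n.choose a * (n + 1) / (a + 1) := by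
  have h : (a + 1 : ℚ) ≠ 0 := by positivity
  rw [Nat.choose_succ_succ, Nat.cast_add, cast_choose_succ_right]
  field_simp
  ring

lemma avoidingFormula_rec (t u a : ℕ) :
    avoidingFormula (t + 1) (u + 1) (a + 1) + avoidingFormula (t + 1) u (a + 1) =
      avoidingFormula (t + 2) u (a + 1) + avoidingFormula t (u + 1) (a + 1) +
        avoidingFormula (t + 1) u a := by
  obtain ⟨N, hN⟩ : ∃ N, N = t + u + 2 := ⟨_, rfl⟩
  have h₁ : t + 1 + (u + 1) + 1 = N + 1 := by omega
  have h₂ : t + 1 + u + 1 = N := by omega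
  have h₃ : t + 2 + u + 1 = N + 1 := by omega
  have h₄ : t + (u + 1) + 1 = N := by omega
  simp only [avoidingFormula, h₁, h₂, h₃, h₄]
  rw [cast_choose_succ_succ u, cast_choose_succ_succ N, cast_choose_succ_right u,
    cast_choose_succ_right N, hN]
  push_cast
  field_simp
  ring

lemma avoidingFormula_rec_zero (u a : ℕ) :
    avoidingFormula 0 (u + 1) (a + 1) =
      avoidingFormula 1 u (a + 1) + avoidingFormula 0 u a := by
  have h₁ : 0 + (u + 1) + 1 = u + 1 + 1 := by omega
  have h₂ : 1 + u + 1 = u + 1 + 1 := by omega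
  have h₃ : 0 + u + 1 = u + 1 := by omega
  simp only [avoidingFormula, h₁, h₂, h₃]
  rw [cast_choose_succ_succ u, cast_choose_succ_succ (u + 1), cast_choose_succ_right u]
  push_cast
  field_simp
  ring

lemma numAvoiding_eq_avoidingFormula (t u a : ℕ) :
    (numAvoiding (t + u + 1) a (t + 1) : ℚ) = avoidingFormula t u a := by
  induction u generalizing t a with
  | zero =>
    have hself : numAvoiding (t + 1) a (t + 1) = if a = 0 then 1 else 0 := by
      induction t with
      | zero => exact numAvoiding_one a
      | succ t ih =>
        rw [← ih]
        cases a with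
        | zero =>
          simpa [numAvoiding_eq_zero] using numAvoiding_zero_descents_rec t (t + 1)
        | succ a =>
          simpa [numAvoiding_eq_zero] using numAvoiding_rec t a (t + 1)
    rw [add_zero, hself]
    cases a <;> simp [avoidingFormula_zero, avoidingFormula_zero_succ]
  | succ u ihu =>
    induction t with
    | zero =>
      have hu := ihu 0
      have hu' := ihu 1
      rw [show 1 + u + 1 = u + 2 by ring] at hu'
      simp only [zero_add] at hu ⊢
      cases a with
      | zero =>
        have h := numAvoiding_zero_descents_rec u 0
        rw [numAvoiding_zero] at h
        rw [avoidingFormula_zero, ← avoidingFormula_zero 1 u, ← hu']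
        exact_mod_cast Nat.add_right_cancel h
      | succ a =>
        have h := numAvoiding_rec u a 0
        rw [numAvoiding_zero] at h
        rw [avoidingFormula_rec_zero, ← hu, ← hu']
        norm_cast
        simp only [zero_add, Nat.reduceAdd] at h ⊢
        rw [show u + 1 + 1 = u + 2 from rfl]
        omega
    | succ t iht =>
      have h₁ := ihu (t + 1)
      have h₂ := ihu (t + 2) a
      rw [show t + 1 + u + 1 = t + u + 2 by ring] at h₁
      rw [show t + 2 + u + 1 = t + u + 3 by ring] at h₂
      rw [show t + (u + 1) + 1 = t + u + 2 by ring] at iht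
      rw [show t + 1 + (u + 1) + 1 = t + u + 3 by ring]
      cases a with
      | zero =>
        have h := congrArg (Nat.cast (R := ℚ)) (numAvoiding_zero_descents_rec (t + u + 1) (t + 1))
        push_cast at h
        rw [iht, h₁, h₂] at h
        simpa [avoidingFormula_zero] using h
      | succ a =>
        have h := congrArg (Nat.cast (R := ℚ)) (numAvoiding_rec (t + u + 1) a (t + 1))
        push_cast at h
        rw [iht, h₁, h₁, h₂, ← avoidingFormula_rec] at h
        exact add_right_cancel h

theorem card_avoids312_with_k_descents (n k : ℕ) (hn : 1 ≤ n) :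
    Nat.card {σ : Equiv.Perm (Fin n) // avoids312 σ ∧ des σ = k} =
      n.choose k * n.choose (k + 1) / n := by
  classical
  obtain ⟨n, rfl⟩ := Nat.exists_eq_add_of_le' hn
  have hcard : Nat.card {σ : Equiv.Perm (Fin (n + 1)) // avoids312 σ ∧ des σ = k} =
      numAvoiding (n + 1) k 1 := by
    rw [Nat.card_eq_fintype_card, Fintype.card_subtype, numAvoiding]
    congr! 3 with σ
    have := two_le_card_cuts σ
    omega
  rw [hcard, eq_comm]
  refine Nat.div_eq_of_eq_mul_right n.succ_pos ?_
  have h := numAvoiding_eq_avoidingFormula 0 n k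
  rw [zero_add, zero_add, avoidingFormula, eq_div_iff (by positivity)] at h
  have hchoose : ((n + 1 : ℕ) * n.choose k : ℚ) = (n + 1).choose (k + 1) * (k + 1) := by
    exact_mod_cast Nat.add_one_mul_choose_eq n k
  rw [← Nat.cast_inj (R := ℚ)]
  refine mul_right_cancel₀ (b := (k + 1 : ℚ)) (by positivity) ?_
  push_cast at h hchoose ⊢
  simp only [zero_add, zero_mul, add_zero] at h
  linear_combination -h - (n + 1).choose k * hchoose
end

section
/- The number of permutations of {1,...,n} avoiding the mesh pattern (132, {(2,0)}) with exactly k descents equals S(n, k+1), the Stirling number of the second kind. Equivalently, ∑_{σ ∈ Av_n((132,{(2,0)}))} q^{des σ} = ∑_{k=0}^{n-1} S(n,k+1) q^k. -/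
open Polynomial

/-- `σ` avoids the mesh pattern `(132, {(2,0)})`: every occurrence `a_i a_j a_k` of the
classical pattern `132` admits an index `l` with `j < l < k` and `a_l < a_i`. -/
def avoidsMesh132 {n : ℕ} (σ : Equiv.Perm (Fin n)) : Prop :=
  ∀ i j k : Fin n, i < j → j < k → σ i < σ k → σ k < σ j →
    ∃ l : Fin n, j < l ∧ l < k ∧ σ l < σ i

instance {n : ℕ} : DecidablePred (avoidsMesh132 (n := n)) := fun σ => by
  unfold avoidsMesh132; apply Fintype.decidableForallFintype

/-- Stirling numbers of the second kind. -/
def stirling2 : ℕ → ℕ → ℕ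
  | 0, 0 => 1
  | 0, _ + 1 => 0
  | _ + 1, 0 => 0
  | n + 1, k + 1 => (k + 1) * stirling2 n (k + 1) + stirling2 n k

/-- The one-line word of `σ`, extended by `0` beyond its length. -/
def word {n : ℕ} (σ : Equiv.Perm (Fin n)) (i : ℕ) : ℕ :=
  if h : i < n then (σ ⟨i, h⟩ : ℕ) else 0

lemma word_coe {n : ℕ} (σ : Equiv.Perm (Fin n)) (i : Fin n) : word σ i = σ i := by
  simp [word]

lemma word_lt {n : ℕ} (σ : Equiv.Perm (Fin n)) {i : ℕ} (hi : i < n) : word σ i < n := by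
  simp [word, hi]

lemma word_injOn {n : ℕ} (σ : Equiv.Perm (Fin n)) {i j : ℕ} (hi : i < n) (hj : j < n)
    (h : word σ i = word σ j) : i = j := by
  simpa [word, hi, hj, Fin.val_inj] using h

/-- The positions of the descents of `σ`, as natural numbers. -/
def descentSet {n : ℕ} (σ : Equiv.Perm (Fin n)) : Finset ℕ :=
  (Finset.range n).filter (fun i => i + 1 < n ∧ word σ (i + 1) < word σ i)

lemma mem_descentSet {n : ℕ} {σ : Equiv.Perm (Fin n)} {i : ℕ} :
    i ∈ descentSet σ ↔ i + 1 < n ∧ word σ (i + 1) < word σ i := by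
  simp only [descentSet, Finset.mem_filter, Finset.mem_range]
  omega

lemma des_eq_card_descentSet {n : ℕ} (σ : Equiv.Perm (Fin n)) :
    des σ = (descentSet σ).card := by
  rw [des, ← Finset.card_map Fin.valEmbedding]
  congr 1
  ext i
  simp only [Finset.mem_map, Finset.mem_filter, Finset.mem_univ, true_and, mem_descentSet,
    Fin.valEmbedding_apply]
  constructor
  · rintro ⟨i, ⟨h, hlt⟩, rfl⟩
    exact ⟨h, by simpa [word, h] using hlt⟩
  · rintro ⟨h, hlt⟩
    have hi : i < n := by omega
    exact ⟨⟨i, hi⟩, ⟨h, by simpa [word, h, hi] using hlt⟩, rfl⟩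

lemma des_lt {n : ℕ} (hn : 1 ≤ n) (σ : Equiv.Perm (Fin n)) : des σ < n := by
  have hsub : descentSet σ ⊆ Finset.range (n - 1) := fun i hi => by
    rw [mem_descentSet] at hi
    rw [Finset.mem_range]
    omega
  have hcard := Finset.card_le_card hsub
  rw [Finset.card_range] at hcard
  rw [des_eq_card_descentSet]
  omega

lemma avoidsMesh132_iff_word {n : ℕ} (σ : Equiv.Perm (Fin n)) :
    avoidsMesh132 σ ↔ ∀ i j k : ℕ, i < j → j < k → k < n → word σ i < word σ k →
      word σ k < word σ j → ∃ l, j < l ∧ l < k ∧ word σ l < word σ i := by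
  constructor
  · intro h i j k hij hjk hk hik hkj
    have hi : i < n := by omega
    have hj : j < n := by omega
    obtain ⟨l, hl⟩ := h ⟨i, hi⟩ ⟨j, hj⟩ ⟨k, hk⟩ hij hjk (by simpa [word, hi, hk] using hik)
      (by simpa [word, hj, hk] using hkj)
    exact ⟨l, hl.1, hl.2.1, by simpa [word, hi] using hl.2.2⟩
  · intro h i j k hij hjk hik hkj
    obtain ⟨l, hjl, hlk, hli⟩ := h i j k hij hjk k.2 (by simpa [word_coe] using hik)
      (by simpa [word_coe] using hkj)
    have hl : l < n := by omega
    exact ⟨⟨l, hl⟩, hjl, hlk, by simpa [word, hl] using hli⟩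

/-- Insert a new largest letter into `σ` at position `p`. -/
def insertMax {n : ℕ} (p : Fin (n + 1)) (σ : Equiv.Perm (Fin n)) : Equiv.Perm (Fin (n + 1)) :=
  (finSuccEquiv' p).trans ((Equiv.optionCongr σ).trans (finSuccEquiv' (Fin.last n)).symm)

lemma insertMax_self {n : ℕ} (p : Fin (n + 1)) (σ : Equiv.Perm (Fin n)) :
    insertMax p σ p = Fin.last n := by
  simp [insertMax]

lemma insertMax_succAbove {n : ℕ} (p : Fin (n + 1)) (σ : Equiv.Perm (Fin n)) (i : Fin n) :
    insertMax p σ (p.succAbove i) = (σ i).castSucc := by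
  simp [insertMax]

lemma insertMax_bijective (n : ℕ) :
    Function.Bijective (fun x : Fin (n + 1) × Equiv.Perm (Fin n) => insertMax x.1 x.2) := by
  rw [Fintype.bijective_iff_injective_and_card]
  constructor
  · rintro ⟨p, σ⟩ ⟨q, τ⟩ h
    simp only at h
    obtain rfl : p = q := by
      apply (insertMax p σ).injective
      rw [insertMax_self, h, insertMax_self]
    congr 1
    ext i
    have hi := insertMax_succAbove p σ i
    rw [h, insertMax_succAbove] at hi
    simpa using congrArg Fin.val hi.symm
  · simp [Fintype.card_perm, Nat.factorial_succ]

lemma word_insertMax_of_lt {n : ℕ} (p : Fin (n + 1)) (σ : Equiv.Perm (Fin n)) {i : ℕ}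
    (h : i < p) : word (insertMax p σ) i = word σ i := by
  have hi : i < n := by omega
  have key := insertMax_succAbove p σ ⟨i, hi⟩
  rw [Fin.succAbove_of_castSucc_lt _ _ (by simpa [Fin.lt_def] using h)] at key
  have hval := congrArg Fin.val key
  simp only [Fin.castSucc_mk, Fin.val_castSucc] at hval
  simpa [word, hi, show i < n + 1 by omega] using hval

lemma word_insertMax_self {n : ℕ} (p : Fin (n + 1)) (σ : Equiv.Perm (Fin n)) :
    word (insertMax p σ) p = n := by
  rw [word_coe, insertMax_self, Fin.val_last]

lemma word_insertMax_succ {n : ℕ} (p : Fin (n + 1)) (σ : Equiv.Perm (Fin n)) {i : ℕ}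
    (h : p ≤ i) : word (insertMax p σ) (i + 1) = word σ i := by
  by_cases hi : i < n
  · have key := insertMax_succAbove p σ ⟨i, hi⟩
    rw [Fin.succAbove_of_le_castSucc _ _ (by simpa [Fin.le_def] using h)] at key
    have hval := congrArg Fin.val key
    simp only [Fin.succ_mk, Fin.val_castSucc] at hval
    simpa [word, hi] using hval
  · simp [word, hi]

lemma word_insertMax_skip {n : ℕ} (p : Fin (n + 1)) (σ : Equiv.Perm (Fin n)) (i : ℕ) :
    word (insertMax p σ) (if i < p then i else i + 1) = word σ i := by
  split_ifs with h
  · exact word_insertMax_of_lt p σ h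
  · exact word_insertMax_succ p σ (not_lt.mp h)

lemma exists_skip {p i : ℕ} (h : i ≠ p) : ∃ j, i = if j < p then j else j + 1 := by
  by_cases hi : i < p
  · exact ⟨i, by simp [hi]⟩
  · exact ⟨i - 1, by rw [if_neg] <;> omega⟩

/-- The sites other than the front where a new largest letter preserves avoidance. -/
def innerSite {n : ℕ} (σ : Equiv.Perm (Fin n)) (p : ℕ) : Prop :=
  p = n ∨ ∃ q ∈ descentSet σ, p = q + 1

lemma avoidsMesh132_of_insertMax {n : ℕ} {p : Fin (n + 1)} {σ : Equiv.Perm (Fin n)}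
    (h : avoidsMesh132 (insertMax p σ)) : avoidsMesh132 σ := by
  rw [avoidsMesh132_iff_word] at h ⊢
  intro i j k hij hjk hk hik hkj
  obtain ⟨l, hjl, hlk, hli⟩ := h (if i < p then i else i + 1) (if j < p then j else j + 1)
    (if k < p then k else k + 1) (by split_ifs <;> omega) (by split_ifs <;> omega)
    (by split_ifs <;> omega) (by simpa only [word_insertMax_skip] using hik)
    (by simpa only [word_insertMax_skip] using hkj)
  rw [word_insertMax_skip] at hli
  have hne : l ≠ p := by
    rintro rfl
    rw [word_insertMax_self] at hli
    have := word_lt σ (show i < n by omega)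
    omega
  obtain ⟨m, rfl⟩ := exists_skip hne
  rw [word_insertMax_skip] at hli
  exact ⟨m, by split_ifs at hjl <;> omega, by split_ifs at hlk <;> omega, hli⟩

lemma site_of_avoidsMesh132_insertMax {n : ℕ} {p : Fin (n + 1)} {σ : Equiv.Perm (Fin n)}
    (h : avoidsMesh132 (insertMax p σ)) : (p : ℕ) = 0 ∨ innerSite σ p := by
  rw [avoidsMesh132_iff_word] at h
  by_contra! hp
  obtain ⟨hp0, hp⟩ := hp
  obtain ⟨q, hq⟩ : ∃ q, (p : ℕ) = q + 1 := ⟨p - 1, by omega⟩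
  have hpn : (p : ℕ) ≠ n := fun hpn => hp (Or.inl hpn)
  have hqn : q + 1 < n := by omega
  have hnd : ¬ word σ (q + 1) < word σ q := fun hd =>
    hp (Or.inr ⟨q, mem_descentSet.mpr ⟨hqn, hd⟩, hq⟩)
  have hne : word σ q ≠ word σ (q + 1) := fun he => by
    have := word_injOn σ (by omega) hqn he
    omega
  have hq' := word_insertMax_of_lt p σ (show q < p by omega)
  have hp' := word_insertMax_self p σ
  have hs' := word_insertMax_succ p σ (le_refl (p : ℕ))
  have hlt := word_lt σ hqn
  rw [← hq] at hlt hnd hne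
  obtain ⟨l, hl⟩ := h q p (p + 1) (by omega) (by omega) (by omega) (by omega) (by omega)
  omega

lemma avoidsMesh132_insertMax {n : ℕ} {p : Fin (n + 1)} {σ : Equiv.Perm (Fin n)}
    (h : avoidsMesh132 σ) (hp : (p : ℕ) = 0 ∨ innerSite σ p) :
    avoidsMesh132 (insertMax p σ) := by
  rw [avoidsMesh132_iff_word] at h ⊢
  have hmax : ∀ i < n + 1, word (insertMax p σ) i ≤ n := fun i hi =>
    Nat.lt_succ_iff.mp (word_lt _ hi)
  have hself := word_insertMax_self p σ
  intro i j k hij hjk hk hik hkj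
  have hip : i ≠ p := by
    rintro rfl
    have := hmax k hk
    omega
  have hkp : k ≠ p := by
    rintro rfl
    have := hmax j (by omega)
    omega
  by_cases hjp : j = p
  · subst hjp
    have hs := word_insertMax_succ p σ (le_refl (p : ℕ))
    have hi := word_insertMax_of_lt p σ hij
    by_cases hlt : word σ p < word σ i
    · refine ⟨p + 1, by omega, ?_, by omega⟩
      rcases Nat.lt_or_ge (p + 1) k with hk' | hk'
      · exact hk'
      · obtain rfl : k = p + 1 := by omega
        omega
    · obtain hp | hp | ⟨q, hq, hpq⟩ := hp
      · omega
      · omega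
      · rw [mem_descentSet] at hq
        rw [hpq] at hlt hij
        have hne : word σ i ≠ word σ (q + 1) := fun he => by
          have := word_injOn σ (by omega) hq.1 he
          omega
        have hiq : i ≠ q := by
          rintro rfl
          omega
        obtain ⟨l, hl⟩ := h i q (q + 1) (by omega) (by omega) hq.1 (by omega) hq.2
        omega
  · obtain ⟨i, rfl⟩ := exists_skip hip
    obtain ⟨j, rfl⟩ := exists_skip hjp
    obtain ⟨k, rfl⟩ := exists_skip hkp
    rw [word_insertMax_skip] at hik hkj
    rw [word_insertMax_skip] at hik hkj
    obtain ⟨l, hjl, hlk, hli⟩ := h i j k (by split_ifs at hij <;> omega)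
      (by split_ifs at hjk <;> omega) (by split_ifs at hk <;> omega) hik hkj
    exact ⟨if l < p then l else l + 1, by split_ifs <;> omega, by split_ifs <;> omega,
      by simpa only [word_insertMax_skip] using hli⟩

lemma avoidsMesh132_insertMax_iff {n : ℕ} (p : Fin (n + 1)) (σ : Equiv.Perm (Fin n)) :
    avoidsMesh132 (insertMax p σ) ↔ avoidsMesh132 σ ∧ ((p : ℕ) = 0 ∨ innerSite σ p) :=
  ⟨fun h => ⟨avoidsMesh132_of_insertMax h, site_of_avoidsMesh132_insertMax h⟩,
    fun h => avoidsMesh132_insertMax h.1 h.2⟩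

lemma des_insertMax_zero {n : ℕ} (hn : 1 ≤ n) (σ : Equiv.Perm (Fin n)) :
    des (insertMax 0 σ) = des σ + 1 := by
  have hset : descentSet (insertMax 0 σ) =
      insert 0 ((descentSet σ).map ⟨Nat.succ, Nat.succ_injective⟩) := by
    have hsucc : ∀ i, word (insertMax 0 σ) (i + 1) = word σ i := fun i =>
      word_insertMax_succ 0 σ (Nat.zero_le i)
    ext i
    cases i with
    | zero =>
      have h0 : word (insertMax 0 σ) 0 = n := word_insertMax_self 0 σ
      simp [mem_descentSet, hsucc 0, h0, word_lt σ hn, Nat.lt_of_succ_le hn]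
    | succ i => simp [mem_descentSet, hsucc]
  rw [des_eq_card_descentSet, des_eq_card_descentSet, hset, Finset.card_insert_of_notMem (by simp),
    Finset.card_map]

lemma des_insertMax_of_innerSite {n : ℕ} {p : Fin (n + 1)} {σ : Equiv.Perm (Fin n)}
    (hp : innerSite σ p) : des (insertMax p σ) = des σ := by
  rw [des_eq_card_descentSet, des_eq_card_descentSet]
  symm
  refine Finset.card_bij (fun i _ => if i + 1 < p then i else i + 1) ?_ ?_ ?_
  · intro i hi
    rw [mem_descentSet] at hi ⊢
    split_ifs with h
    · rw [word_insertMax_of_lt p σ h, word_insertMax_of_lt p σ (by omega)]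
      exact ⟨by omega, hi.2⟩
    · rw [word_insertMax_succ p σ (by omega)]
      refine ⟨by omega, ?_⟩
      rcases Nat.lt_or_ge i p with hip | hip
      · obtain hip' : i + 1 = p := by omega
        rw [hip', word_insertMax_self]
        rw [← hip']
        exact word_lt σ hi.1
      · rw [word_insertMax_succ p σ hip]
        exact hi.2
  · intro i _ j _ h
    split_ifs at h <;> omega
  · intro i hi
    rw [mem_descentSet] at hi
    rcases lt_trichotomy i p with hip | rfl | hip
    · rw [word_insertMax_of_lt p σ hip] at hi
      have hne : i + 1 ≠ p := fun he => by
        rw [he, word_insertMax_self] at hi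
        have := word_lt σ (show i < n by omega)
        omega
      rw [word_insertMax_of_lt p σ (show i + 1 < p by omega)] at hi
      exact ⟨i, mem_descentSet.mpr ⟨by omega, hi.2⟩, by rw [if_pos (by omega)]⟩
    · obtain hp | ⟨q, hq, hpq⟩ := hp
      · omega
      · exact ⟨q, hq, by rw [if_neg (by omega), hpq]⟩
    · obtain ⟨j, rfl⟩ : ∃ j, i = j + 1 := ⟨i - 1, by omega⟩
      rw [word_insertMax_succ p σ (by omega), word_insertMax_succ p σ (by omega)] at hi
      exact ⟨j, mem_descentSet.mpr ⟨by omega, hi.2⟩, by rw [if_neg (by omega)]⟩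

open Classical in
lemma card_innerSite {n : ℕ} (σ : Equiv.Perm (Fin n)) :
    (Finset.univ.filter (fun p : Fin (n + 1) => innerSite σ p)).card = des σ + 1 := by
  have hset : (Finset.univ.filter (fun p : Fin (n + 1) => innerSite σ p)).map Fin.valEmbedding =
      insert n ((descentSet σ).map ⟨Nat.succ, Nat.succ_injective⟩) := by
    ext i
    simp only [Finset.mem_map, Finset.mem_filter, Finset.mem_univ, true_and,
      Fin.valEmbedding_apply, Finset.mem_insert, Function.Embedding.coeFn_mk, Nat.succ_eq_add_one]
    constructor
    · rintro ⟨p, hp | ⟨q, hq, hp⟩, rfl⟩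
      · exact Or.inl hp
      · exact Or.inr ⟨q, hq, hp.symm⟩
    · rintro (rfl | ⟨q, hq, rfl⟩)
      · exact ⟨Fin.last _, Or.inl rfl, rfl⟩
      · have hq' := (mem_descentSet.mp hq).1
        exact ⟨⟨q + 1, by omega⟩, Or.inr ⟨q, hq, rfl⟩, rfl⟩
  rw [← Finset.card_map Fin.valEmbedding, hset, Finset.card_insert_of_notMem, Finset.card_map,
    des_eq_card_descentSet]
  simp only [Finset.mem_map, mem_descentSet, Function.Embedding.coeFn_mk, not_exists, not_and]
  omega

lemma card_insertMax_des_eq {n : ℕ} (hn : 1 ≤ n) {σ : Equiv.Perm (Fin n)}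
    (hσ : avoidsMesh132 σ) (k : ℕ) :
    (Finset.univ.filter (fun p : Fin (n + 1) =>
      avoidsMesh132 (insertMax p σ) ∧ des (insertMax p σ) = k)).card =
      (if des σ = k then k + 1 else 0) + (if des σ + 1 = k then 1 else 0) := by
  classical
  have hzero : ¬ innerSite σ 0 := by
    rintro (h | ⟨q, _, h⟩) <;> omega
  have hset : Finset.univ.filter (fun p : Fin (n + 1) =>
      avoidsMesh132 (insertMax p σ) ∧ des (insertMax p σ) = k) =
      Finset.univ.filter (fun p : Fin (n + 1) => innerSite σ p ∧ des σ = k) ∪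
      Finset.univ.filter (fun p : Fin (n + 1) => p = 0 ∧ des σ + 1 = k) := by
    ext p
    simp only [Finset.mem_filter, Finset.mem_univ, true_and, Finset.mem_union,
      avoidsMesh132_insertMax_iff, hσ]
    by_cases hp : p = 0
    · subst hp
      simp [des_insertMax_zero hn, hzero]
    · have hp' : (p : ℕ) ≠ 0 := fun h => hp (Fin.ext h)
      simp only [hp, hp', false_or, false_and, or_false]
      exact and_congr_right fun h => by rw [des_insertMax_of_innerSite h]
  rw [hset, Finset.card_union_of_disjoint]
  · congr 1
    · split_ifs with h
      · simp only [h, and_true, card_innerSite]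
      · simp [h]
    · split_ifs with h
      · simp [h, Finset.filter_eq']
      · simp [h]
  · rw [Finset.disjoint_filter]
    rintro p _ ⟨hp, _⟩ ⟨rfl, _⟩
    exact hzero hp

lemma card_avoidsMesh132_succ {n : ℕ} (hn : 1 ≤ n) (k : ℕ) :
    (Finset.univ.filter (fun σ : Equiv.Perm (Fin (n + 1)) => avoidsMesh132 σ ∧ des σ = k)).card =
      (k + 1) * (Finset.univ.filter (fun σ : Equiv.Perm (Fin n) =>
        avoidsMesh132 σ ∧ des σ = k)).card +
      (Finset.univ.filter (fun σ : Equiv.Perm (Fin n) =>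
        avoidsMesh132 σ ∧ des σ + 1 = k)).card := by
  have hfiber : ∀ σ : Equiv.Perm (Fin n),
      (∑ p : Fin (n + 1), if avoidsMesh132 (insertMax p σ) ∧ des (insertMax p σ) = k
        then 1 else 0) =
      (k + 1) * (if avoidsMesh132 σ ∧ des σ = k then 1 else 0) +
        (if avoidsMesh132 σ ∧ des σ + 1 = k then 1 else 0) := fun σ => by
    rw [← Finset.card_filter]
    by_cases hσ : avoidsMesh132 σ
    · rw [card_insertMax_des_eq hn hσ]
      simp [hσ]
    · simp [hσ, avoidsMesh132_insertMax_iff]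
  rw [Finset.card_filter, ← (insertMax_bijective n).sum_comp, Fintype.sum_prod_type_right]
  simp only [hfiber]
  rw [Finset.sum_add_distrib, ← Finset.mul_sum, ← Finset.card_filter, ← Finset.card_filter]

lemma card_filter_avoidsMesh132 {n : ℕ} (hn : 1 ≤ n) (k : ℕ) :
    (Finset.univ.filter (fun σ : Equiv.Perm (Fin n) => avoidsMesh132 σ ∧ des σ = k)).card =
      stirling2 n (k + 1) := by
  induction n, hn using Nat.le_induction generalizing k with
  | base =>
    have hav : ∀ σ : Equiv.Perm (Fin 1), avoidsMesh132 σ := fun σ i j k hij => by omega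
    have hdes : ∀ σ : Equiv.Perm (Fin 1), des σ = 0 := fun σ =>
      Nat.lt_one_iff.mp (des_lt le_rfl σ)
    cases k <;> simp [hav, hdes, stirling2]
  | succ n hn ih =>
    rw [card_avoidsMesh132_succ hn, ih, stirling2]
    congr 1
    cases k with
    | zero =>
      obtain ⟨m, rfl⟩ : ∃ m, n = m + 1 := ⟨n - 1, by omega⟩
      simp [stirling2]
    | succ k => simp [ih]

theorem card_avoidsMesh132_eq_stirling (n : ℕ) (hn : 1 ≤ n) :
    (∀ k : ℕ,
      Nat.card {σ : Equiv.Perm (Fin n) // avoidsMesh132 σ ∧ des σ = k} =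
        stirling2 n (k + 1)) ∧
    (∑ σ ∈ Finset.univ.filter (fun σ : Equiv.Perm (Fin n) => avoidsMesh132 σ),
        (X : Polynomial ℤ) ^ des σ =
      ∑ k ∈ Finset.range n, (stirling2 n (k + 1) : Polynomial ℤ) * X ^ k) := by
  refine ⟨fun k => ?_, ?_⟩
  · rw [Nat.card_eq_fintype_card, Fintype.card_subtype, card_filter_avoidsMesh132 hn]
  · rw [← Finset.sum_fiberwise_of_maps_to (t := Finset.range n) (g := des)
      (fun σ _ => Finset.mem_range.mpr (des_lt hn σ))]
    refine Finset.sum_congr rfl fun k _ => ?_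
    rw [Finset.filter_filter, ← card_filter_avoidsMesh132 hn k, ← nsmul_eq_mul]
    refine Finset.sum_eq_card_nsmul fun σ hσ => ?_
    rw [(Finset.mem_filter.mp hσ).2.2]
end

section
/- The number of permutations of {1,...,n} that avoid both the classical pattern 321 and the mesh pattern (231, {(1,0)}), and have exactly k descents, equals the number of Motzkin paths of length n with exactly k up-steps. -/
/-- `σ` avoids the classical pattern `321`. -/
def avoids321 {n : ℕ} (σ : Equiv.Perm (Fin n)) : Prop :=
  ¬ ∃ i j k : Fin n, i < j ∧ j < k ∧ σ j < σ i ∧ σ k < σ j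

/-- `σ` avoids the mesh pattern `(231, {(1,0)})`: every occurrence `a_i a_j a_k` of the
pattern `231` admits an index `l` with `i < l < j` and `a_l < a_k`. -/
def avoidsMesh231 {n : ℕ} (σ : Equiv.Perm (Fin n)) : Prop :=
  ∀ i j k : Fin n, i < j → j < k → σ k < σ i → σ i < σ j →
    ∃ l : Fin n, i < l ∧ l < j ∧ σ l < σ k

/-- `p` is a Motzkin path of length `n`, recorded as the list of the `y`-displacements of its
steps: up-step `1`, down-step `-1`, horizontal step `0`. -/
def IsMotzkin (n : ℕ) (p : List ℤ) : Prop :=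
  p.length = n ∧ (∀ x ∈ p, x = 1 ∨ x = -1 ∨ x = 0) ∧
    (∀ t : ℕ, 0 ≤ (p.take t).sum) ∧ p.sum = 0

open Polynomial

namespace MotzkinAvoiders

/-- The permutation whose one-line notation is `v` followed by a word order-isomorphic to `τ`. -/
def consPerm {n : ℕ} (v : Fin (n + 1)) (τ : Equiv.Perm (Fin n)) : Equiv.Perm (Fin (n + 1)) :=
  (finSuccEquiv' 0).trans ((Equiv.optionCongr τ).trans (finSuccEquiv' v).symm)

@[simp]
theorem consPerm_zero {n : ℕ} (v : Fin (n + 1)) (τ : Equiv.Perm (Fin n)) :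
    consPerm v τ 0 = v := by
  simp [consPerm]

@[simp]
theorem consPerm_succ {n : ℕ} (v : Fin (n + 1)) (τ : Equiv.Perm (Fin n)) (i : Fin n) :
    consPerm v τ i.succ = v.succAbove (τ i) := by
  have h : finSuccEquiv' 0 i.succ = some i := by simp
  simp [consPerm, h]

theorem consPerm_bijective (n : ℕ) :
    Function.Bijective (fun p : Fin (n + 1) × Equiv.Perm (Fin n) => consPerm p.1 p.2) := by
  rw [Fintype.bijective_iff_injective_and_card]
  refine ⟨?_, by simp [Fintype.card_perm, Nat.factorial_succ]⟩
  rintro ⟨v, τ⟩ ⟨w, ρ⟩ h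
  have hv : v = w := by simpa using congrArg (fun σ : Equiv.Perm (Fin (n + 1)) => σ 0) h
  subst hv
  refine Prod.ext rfl (Equiv.ext fun i => ?_)
  simpa using congrArg (fun σ : Equiv.Perm (Fin (n + 1)) => σ i.succ) h

theorem sum_perm_succ {M : Type*} [AddCommMonoid M] {n : ℕ}
    (g : Equiv.Perm (Fin (n + 1)) → M) :
    ∑ σ, g σ = ∑ v, ∑ τ, g (consPerm v τ) := by
  rw [← (consPerm_bijective n).sum_comp g, Fintype.sum_prod_type]

theorem val_succAbove {n : ℕ} (v : Fin (n + 1)) (x : Fin n) :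
    (v.succAbove x : ℕ) = if (x : ℕ) < v then (x : ℕ) else x + 1 := by
  simp only [Fin.succAbove, Fin.lt_def, Fin.val_castSucc]
  split_ifs <;> simp

/-- An avoider of `321` in which every entry exceeding some later entry is a descent top, and in
which the `h` smallest values appear in increasing order. -/
structure IsGood {n : ℕ} (h : ℕ) (σ : Equiv.Perm (Fin n)) : Prop where
  le : h ≤ n
  le_top : ∀ i j : Fin n, i < j → σ j < σ i → h ≤ σ i
  no321 : ∀ i j k : Fin n, i < j → j < k → σ j < σ i → ¬ σ k < σ j
  descent : ∀ i j k : Fin n, (i : ℕ) + 1 = j → i < k → σ k < σ i → σ j < σ i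

theorem isGood_zero_iff {n : ℕ} (σ : Equiv.Perm (Fin n)) :
    IsGood 0 σ ↔ avoids321 σ ∧ avoidsMesh231 σ := by
  constructor
  · intro hσ
    refine ⟨fun ⟨i, j, k, hij, hjk, h₁, h₂⟩ => hσ.no321 i j k hij hjk h₁ h₂, ?_⟩
    intro i j k hij hjk hki hlt
    have hl : (i : ℕ) + 1 < n := by omega
    have hd := hσ.descent i ⟨i + 1, hl⟩ k rfl (hij.trans hjk) hki
    have hil : i < (⟨i + 1, hl⟩ : Fin n) := Fin.lt_def.2 (by simp)
    have hlj : (⟨i + 1, hl⟩ : Fin n) < j := by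
      refine lt_of_le_of_ne (Fin.le_def.2 (by simpa using Fin.lt_def.1 hij)) ?_
      rintro rfl
      exact absurd hd hlt.asymm
    refine ⟨_, hil, hlj, ?_⟩
    refine lt_of_le_of_ne (not_lt.1 (hσ.no321 i _ k hil (hlj.trans hjk) hd)) ?_
    exact fun h => (hlj.trans hjk).ne (σ.injective h)
  · rintro ⟨h321, hmesh⟩
    refine ⟨Nat.zero_le _, fun _ _ _ _ => Nat.zero_le _,
      fun i j k hij hjk h₁ h₂ => h321 ⟨i, j, k, hij, hjk, h₁, h₂⟩, ?_⟩
    intro i j k hij hik hki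
    by_contra hji
    have hlt : σ i < σ j := by
      refine lt_of_le_of_ne (not_lt.1 hji) fun h => ?_
      have := σ.injective h
      omega
    have hjk : j < k := by
      refine lt_of_le_of_ne (Fin.le_def.2 (by omega)) ?_
      rintro rfl
      exact hji hki
    obtain ⟨l, hil, hlj, -⟩ := hmesh i j k (Fin.lt_def.2 (by omega)) hjk hki hlt
    omega

theorem isGood_consPerm_zero {n : ℕ} (h : ℕ) (τ : Equiv.Perm (Fin n)) :
    IsGood h (consPerm 0 τ) ↔ IsGood (h - 1) τ := by
  constructor
  · rintro ⟨h₁, h₂, h₃, h₄⟩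
    refine ⟨by omega, fun i j hij hlt => ?_, fun i j k hij hjk hlt => ?_,
      fun i j k hij hik hlt => ?_⟩
    · have := h₂ i.succ j.succ (by simpa) (by simpa)
      simp at this
      omega
    · simpa using h₃ i.succ j.succ k.succ (by simpa) (by simpa) (by simpa)
    · simpa using h₄ i.succ j.succ k.succ (by simpa) (by simpa) (by simpa)
  · rintro ⟨h₁, h₂, h₃, h₄⟩
    refine ⟨by omega, fun i j => ?_, fun i j k => ?_, fun i j k => ?_⟩
    · cases i using Fin.cases <;> cases j using Fin.cases <;> simp
      rename_i i j
      intro hij hlt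
      have := h₂ i j hij hlt
      omega
    · cases i using Fin.cases <;> cases j using Fin.cases <;> cases k using Fin.cases <;> simp
      simpa using h₃ _ _ _
    · cases i using Fin.cases <;> cases j using Fin.cases <;> cases k using Fin.cases <;> simp
      simpa using h₄ _ _ _

theorem isGood_consPerm_of_pos {n : ℕ} (h : ℕ) {v : Fin (n + 2)} (hv : v ≠ 0)
    (τ : Equiv.Perm (Fin (n + 1))) :
    IsGood h (consPerm v τ) ↔ h ≤ v ∧ IsGood v τ ∧ (τ 0 : ℕ) < v := by
  have hv' : 0 < (v : ℕ) := Nat.pos_of_ne_zero fun h => hv (Fin.ext h)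
  have hlt : ∀ x : Fin (n + 1), v.succAbove x < v ↔ (x : ℕ) < v := fun x => by
    rw [Fin.lt_def, val_succAbove]; split_ifs <;> omega
  constructor
  · rintro ⟨h₁, h₂, h₃, h₄⟩
    obtain ⟨z, hz⟩ := τ.surjective 0
    have hzv : v.succAbove (τ z) < v := by simpa [hlt, hz]
    refine ⟨by simpa using h₂ 0 z.succ (Fin.succ_pos _) (by simpa), ⟨by omega,
      fun i j hij hji => ?_, fun i j k hij hjk hji => ?_, fun i j k hij hik hki => ?_⟩, ?_⟩
    · by_contra hi
      exact h₃ 0 i.succ j.succ (Fin.succ_pos _) (by simpa) (by simpa [hlt] using hi) (by simpa)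
    · simpa using h₃ i.succ j.succ k.succ (by simpa) (by simpa) (by simpa)
    · simpa using h₄ i.succ j.succ k.succ (by simpa) (by simpa) (by simpa)
    · have := h₄ 0 (Fin.succ 0) z.succ (by simp) (Fin.succ_pos _) (by simpa)
      rwa [consPerm_zero, consPerm_succ, hlt] at this
  · rintro ⟨hle, ⟨h₁, h₂, h₃, h₄⟩, h0⟩
    refine ⟨by omega, fun i j => ?_, fun i j k => ?_, fun i j k => ?_⟩
    · cases i using Fin.cases with
      | zero => simp [hle]
      | succ i =>
        cases j using Fin.cases with
        | zero => simp
        | succ j =>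
          simp only [consPerm_succ, Fin.succ_lt_succ_iff, Fin.succAbove_lt_succAbove_iff]
          intro hij hji
          have := h₂ i j hij hji
          rw [val_succAbove]
          split_ifs <;> omega
    · cases k using Fin.cases with
      | zero => simp
      | succ k =>
        cases j using Fin.cases with
        | zero => simp
        | succ j =>
          cases i using Fin.cases with
          | zero =>
            simp only [consPerm_succ, consPerm_zero, Fin.succ_lt_succ_iff,
              Fin.succAbove_lt_succAbove_iff, hlt]
            intro _ hjk hj hkj
            have := h₂ j k hjk hkj
            omega
          | succ i => simpa using h₃ i j k
    · cases k using Fin.cases with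
      | zero => simp
      | succ k =>
        cases j using Fin.cases with
        | zero => simp
        | succ j =>
          cases i using Fin.cases with
          | zero =>
            simp only [consPerm_succ, consPerm_zero, hlt]
            intro hj _ _
            have : j = 0 := Fin.ext (by simpa using hj.symm)
            rwa [this]
          | succ i => simpa using h₄ i j k

theorem isGood_consPerm_consPerm {n : ℕ} (h : ℕ) {v : Fin (n + 2)} (hv : v ≠ 0)
    (w : Fin (n + 1)) (τ : Equiv.Perm (Fin n)) :
    IsGood h (consPerm v (consPerm w τ)) ↔ h ≤ v ∧ w = 0 ∧ IsGood (v - 1) τ := by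
  have hv' : 0 < (v : ℕ) := Nat.pos_of_ne_zero fun h => hv (Fin.ext h)
  rw [isGood_consPerm_of_pos h hv, consPerm_zero]
  refine and_congr_right fun _ => ⟨fun ⟨hg, hw⟩ => ?_, ?_⟩
  · have hw0 : w = 0 := by
      by_contra hne
      obtain ⟨z, hz⟩ := (consPerm w τ).surjective 0
      have hz0 : 0 < z := by
        refine Fin.pos_of_ne_zero ?_
        rintro rfl
        exact hne (by simpa using hz)
      have := hg.le_top 0 z hz0 (by simpa [hz] using Fin.pos_of_ne_zero hne)
      rw [consPerm_zero] at this
      omega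
    subst hw0
    exact ⟨rfl, (isGood_consPerm_zero _ _).1 hg⟩
  · rintro ⟨rfl, hg⟩
    exact ⟨(isGood_consPerm_zero _ _).2 hg, by simpa⟩

theorem des_consPerm {n : ℕ} (v : Fin (n + 2)) (τ : Equiv.Perm (Fin (n + 1))) :
    des (consPerm v τ) = (if (τ 0 : ℕ) < v then 1 else 0) + des τ := by
  have hlt : v.succAbove (τ 0) < v ↔ (τ 0 : ℕ) < v := by
    rw [Fin.lt_def, val_succAbove]; split_ifs <;> omega
  have hone : consPerm v τ 1 = v.succAbove (τ 0) := consPerm_succ v τ 0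
  have hsucc : ∀ (i : ℕ) (hi : i + 1 + 1 < n + 2), consPerm v τ ⟨i + 1 + 1, hi⟩ =
      v.succAbove (τ ⟨i + 1, by omega⟩) := fun i hi => consPerm_succ v τ ⟨i + 1, by omega⟩
  simp only [des, Finset.card_filter]
  rw [Fin.sum_univ_succ]
  congr 1
  · simp [hone, hlt]
  · refine Finset.sum_congr rfl fun i _ => ?_
    simp [hsucc]

theorem des_eq_zero {n : ℕ} (hn : n ≤ 1) (σ : Equiv.Perm (Fin n)) : des σ = 0 := by
  simp only [des, Finset.card_eq_zero, Finset.filter_eq_empty_iff]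
  rintro i - ⟨h, -⟩
  omega

theorem des_consPerm_zero {n : ℕ} (τ : Equiv.Perm (Fin n)) : des (consPerm 0 τ) = des τ := by
  cases n with
  | zero => rw [des_eq_zero (by omega), des_eq_zero (by omega)]
  | succ n => simp [des_consPerm]

open Classical in
/-- The descent polynomial of the good permutations. -/
noncomputable def goodPoly (n h : ℕ) : ℕ[X] :=
  ∑ σ : Equiv.Perm (Fin n), if IsGood h σ then X ^ des σ else 0

theorem goodPoly_zero (h : ℕ) : goodPoly 0 h = if h = 0 then 1 else 0 := by
  have hg : ∀ σ : Equiv.Perm (Fin 0), IsGood h σ ↔ h = 0 := fun σ =>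
    ⟨fun hσ => Nat.le_zero.1 hσ.le, fun hh =>
      ⟨hh.le, fun i => i.elim0, fun i => i.elim0, fun i => i.elim0⟩⟩
  simp [goodPoly, hg, des_eq_zero]

theorem goodPoly_one (h : ℕ) : goodPoly 1 h = goodPoly 0 (h - 1) := by
  classical
  rw [goodPoly, goodPoly, sum_perm_succ,
    Fintype.sum_eq_single 0 fun v hv => absurd (Subsingleton.elim (α := Fin 1) v 0) hv]
  exact Fintype.sum_congr _ _ fun τ =>
    if_congr (isGood_consPerm_zero h τ) (by rw [des_consPerm_zero]) rfl

theorem goodPoly_add_two (n h : ℕ) :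
    goodPoly (n + 2) h =
      goodPoly (n + 1) (h - 1) + X * ∑ j ∈ Finset.Ico (h - 1) (n + 1), goodPoly n j := by
  classical
  rw [goodPoly, sum_perm_succ, Fin.sum_univ_succ]
  congr 1
  · simp only [goodPoly, isGood_consPerm_zero, des_consPerm_zero]
  · have key : ∀ v : Fin (n + 1), (∑ τ : Equiv.Perm (Fin (n + 1)),
        if IsGood h (consPerm v.succ τ) then (X : ℕ[X]) ^ des (consPerm v.succ τ) else 0) =
          if h - 1 ≤ (v : ℕ) then X * goodPoly n v else 0 := by
      intro v
      rw [sum_perm_succ, Finset.sum_eq_single 0]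
      · simp only [isGood_consPerm_consPerm h (Fin.succ_ne_zero v), des_consPerm,
          des_consPerm_zero, consPerm_zero, Fin.val_succ, Nat.add_sub_cancel, true_and,
          ← Nat.sub_le_iff_le_add, goodPoly]
        by_cases hh : h - 1 ≤ (v : ℕ)
        · simp only [hh, true_and, if_true, Finset.mul_sum, mul_ite, mul_zero]
          simp [pow_add]
        · simp [hh, -Nat.sub_le_iff_le_add]
      · intro w _ hw
        simp [isGood_consPerm_consPerm h (Fin.succ_ne_zero v), hw]
      · simp
    rw [Finset.sum_congr rfl fun v _ => key v,
      Fin.sum_univ_eq_sum_range (fun v => if h - 1 ≤ v then X * goodPoly n v else 0) (n + 1),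
      ← Finset.sum_filter, Finset.mul_sum]
    refine Finset.sum_congr ?_ fun _ _ => rfl
    ext j
    simp [and_comm]

/-- The up-step polynomial of the lattice paths with `n` Motzkin steps from height `y` to height
`0` such that at least `h` steps after the first visit to height `0` end at height `0`. -/
noncomputable def pathPoly : ℕ → ℕ → ℕ → ℕ[X]
  | 0, y, h => if y = 0 ∧ h = 0 then 1 else 0
  | n + 1, 0, h => pathPoly n 0 (h - 1) + X * pathPoly n 1 (h - 1)
  | n + 1, y + 1, h => X * pathPoly n (y + 2) h + pathPoly n (y + 1) h + pathPoly n y h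

theorem pathPoly_eq_zero (n y h : ℕ) (hn : n < h) : pathPoly n y h = 0 := by
  induction n generalizing y h with
  | zero => rw [pathPoly, if_neg (by omega)]
  | succ n ih =>
    cases y with
    | zero => rw [pathPoly, ih _ _ (by omega), ih _ _ (by omega)]; simp
    | succ y =>
      rw [pathPoly, ih _ _ (by omega), ih _ _ (by omega), ih _ _ (by omega)]; simp

theorem pathPoly_succ_succ (n N y h : ℕ) (hN : n < N) :
    pathPoly (n + 1) (y + 1) h = ∑ j ∈ Finset.Ico h N, pathPoly n y j := by
  induction n generalizing N y h with
  | zero =>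
    rcases Nat.eq_zero_or_pos h with rfl | hh
    · rw [Finset.sum_eq_sum_Ico_succ_bot hN,
        Finset.sum_eq_zero fun j hj => pathPoly_eq_zero 0 y j (Finset.mem_Ico.1 hj).1]
      simp [pathPoly]
    · rw [Finset.sum_eq_zero fun j hj =>
        pathPoly_eq_zero 0 y j (hh.trans_le (Finset.mem_Ico.1 hj).1)]
      simp [pathPoly, hh.ne']
  | succ n ih =>
    rw [pathPoly]
    cases y with
    | succ y =>
      rw [ih N _ _ (by omega), ih N _ _ (by omega), ih N _ _ (by omega), Finset.mul_sum,
        ← Finset.sum_add_distrib, ← Finset.sum_add_distrib]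
      rfl
    | zero =>
      rcases lt_or_ge h N with hh | hh
      · obtain ⟨N, rfl⟩ : ∃ M, N = M + 1 := ⟨N - 1, by omega⟩
        rw [Finset.sum_eq_sum_Ico_succ_bot hh, ← Finset.sum_Ico_add' _ h N 1,
          ih N _ _ (by omega), ih N _ _ (by omega), Finset.mul_sum, ← Finset.sum_add_distrib,
          add_comm]
        congr 1
        exact Finset.sum_congr rfl fun j _ => by rw [pathPoly, Nat.add_sub_cancel, add_comm]
      · rw [Finset.Ico_eq_empty (by omega), Finset.sum_empty, pathPoly_eq_zero _ _ _ (by omega),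
          pathPoly_eq_zero _ _ _ (by omega), pathPoly_eq_zero _ _ _ (by omega)]
        simp

theorem goodPoly_eq_pathPoly (n h : ℕ) : goodPoly n h = pathPoly n 0 h := by
  induction n using Nat.twoStepInduction generalizing h with
  | zero => simp [goodPoly_zero, pathPoly]
  | one => simp [goodPoly_one, goodPoly_zero, pathPoly]
  | more n ih₁ ih₂ =>
    rw [goodPoly_add_two, pathPoly, ih₂, pathPoly_succ_succ n (n + 1) 0 _ (by omega)]
    simp only [ih₁]

/-- Motzkin paths of length `n` from height `y` to height `0`, as lists of displacements. -/
def IsMotzkinFrom (n : ℕ) (y : ℕ) (p : List ℤ) : Prop :=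
  p.length = n ∧ (∀ x ∈ p, x = 1 ∨ x = -1 ∨ x = 0) ∧
    (∀ t : ℕ, 0 ≤ y + (p.take t).sum) ∧ y + p.sum = 0

/-- Prepending a fixed entry, as an embedding of lists. -/
def consEmb (x : ℤ) : List ℤ ↪ List ℤ := ⟨List.cons x, List.cons_injective⟩

/-- The finite set of Motzkin paths of length `n` from height `y` to height `0`. -/
def motzkinFrom : ℕ → ℕ → Finset (List ℤ)
  | 0, y => if y = 0 then {[]} else ∅
  | n + 1, 0 => (motzkinFrom n 0).map (consEmb 0) ∪ (motzkinFrom n 1).map (consEmb 1)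
  | n + 1, y + 1 => (motzkinFrom n (y + 2)).map (consEmb 1) ∪
      (motzkinFrom n (y + 1)).map (consEmb 0) ∪ (motzkinFrom n y).map (consEmb (-1))

theorem isMotzkinFrom_cons (n y : ℕ) (x : ℤ) (p : List ℤ) :
    IsMotzkinFrom (n + 1) y (x :: p) ↔ (x = 1 ∧ IsMotzkinFrom n (y + 1) p) ∨
      (x = 0 ∧ IsMotzkinFrom n y p) ∨ (x = -1 ∧ 0 < y ∧ IsMotzkinFrom n (y - 1) p) := by
  have htake : (∀ t : ℕ, 0 ≤ (y : ℤ) + ((x :: p).take t).sum) ↔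
      ∀ t : ℕ, 0 ≤ (y : ℤ) + x + (p.take t).sum := by
    refine ⟨fun h t => by simpa [add_assoc] using h (t + 1), fun h t => ?_⟩
    cases t with
    | zero => simp
    | succ t => simpa [add_assoc] using h t
  simp only [IsMotzkinFrom, htake, List.length_cons, List.forall_mem_cons, List.sum_cons,
    Nat.add_right_cancel_iff, ← add_assoc]
  constructor
  · rintro ⟨hl, ⟨rfl | rfl | rfl, hs⟩, ht, h0⟩
    · exact Or.inl ⟨rfl, hl, hs, by simpa using ht, by simpa using h0⟩
    · have hy : 0 < y := by
        have := ht 0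
        simp only [List.take_zero, List.sum_nil] at this
        omega
      refine Or.inr (Or.inr ⟨rfl, hy, hl, hs, ?_⟩)
      rw [Nat.cast_sub hy]
      exact ⟨by simpa [sub_eq_add_neg] using ht, by simpa [sub_eq_add_neg] using h0⟩
    · exact Or.inr (Or.inl ⟨rfl, hl, hs, by simpa using ht, by simpa using h0⟩)
  · rintro (⟨rfl, hl, hs, ht, h0⟩ | ⟨rfl, hl, hs, ht, h0⟩ | ⟨rfl, hy, hl, hs, ht, h0⟩)
    · exact ⟨hl, ⟨by simp, hs⟩, by simpa using ht, by simpa using h0⟩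
    · exact ⟨hl, ⟨by simp, hs⟩, by simpa using ht, by simpa using h0⟩
    · rw [Nat.cast_sub hy] at ht h0
      exact ⟨hl, ⟨by simp, hs⟩, by simpa [sub_eq_add_neg] using ht,
        by simpa [sub_eq_add_neg] using h0⟩

theorem mem_motzkinFrom (n y : ℕ) (p : List ℤ) : p ∈ motzkinFrom n y ↔ IsMotzkinFrom n y p := by
  induction n generalizing y p with
  | zero =>
    rcases Nat.eq_zero_or_pos y with rfl | hy
    · cases p <;> simp [motzkinFrom, IsMotzkinFrom]
    · cases p <;> simp [motzkinFrom, IsMotzkinFrom, hy.ne']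
  | succ n ih =>
    cases p with
    | nil => cases y <;> simp [motzkinFrom, IsMotzkinFrom, consEmb]
    | cons x p =>
      rw [isMotzkinFrom_cons]
      cases y <;> simp [motzkinFrom, consEmb, ih, eq_comm (b := x)] <;> tauto

theorem sum_map_consEmb (s : Finset (List ℤ)) (x : ℤ) :
    ∑ p ∈ s.map (consEmb x), (X : ℕ[X]) ^ p.count 1 =
      (if x = 1 then X else 1) * ∑ p ∈ s, X ^ p.count 1 := by
  rw [Finset.sum_map, Finset.mul_sum]
  refine Finset.sum_congr rfl fun p _ => ?_
  by_cases hx : x = 1 <;> simp [consEmb, hx, pow_succ']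

theorem disjoint_map_consEmb (s t : Finset (List ℤ)) {x y : ℤ} (h : x ≠ y) :
    Disjoint (s.map (consEmb x)) (t.map (consEmb y)) := by
  rw [Finset.disjoint_left]
  simp only [Finset.mem_map, consEmb, Function.Embedding.coeFn_mk]
  rintro _ ⟨p, _, rfl⟩ ⟨q, _, hq⟩
  exact h (List.cons.inj hq).1.symm

theorem sum_motzkinFrom (n y : ℕ) :
    ∑ p ∈ motzkinFrom n y, (X : ℕ[X]) ^ p.count 1 = pathPoly n y 0 := by
  induction n generalizing y with
  | zero => by_cases hy : y = 0 <;> simp [motzkinFrom, pathPoly, hy]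
  | succ n ih =>
    cases y with
    | zero =>
      rw [motzkinFrom, Finset.sum_union (disjoint_map_consEmb _ _ (by decide))]
      simp only [sum_map_consEmb, ih]
      simp [pathPoly]
    | succ y =>
      rw [motzkinFrom, Finset.sum_union (Finset.disjoint_union_left.2
          ⟨disjoint_map_consEmb _ _ (by decide), disjoint_map_consEmb _ _ (by decide)⟩),
        Finset.sum_union (disjoint_map_consEmb _ _ (by decide))]
      simp only [sum_map_consEmb, ih]
      simp [pathPoly]

theorem isMotzkinFrom_zero_iff (n : ℕ) (p : List ℤ) : IsMotzkinFrom n 0 p ↔ IsMotzkin n p := by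
  simp [IsMotzkinFrom, IsMotzkin]

/-- The coefficients of `∑ p ∈ s, X ^ f p` count the fibres of `f` on `s`. -/
theorem card_fiber_eq_coeff {α : Type*} (s : Finset α) (f : α → ℕ) (P : α → Prop)
    (hP : ∀ a, a ∈ s ↔ P a) (k : ℕ) :
    Nat.card {a // P a ∧ f a = k} = (∑ a ∈ s, (X : ℕ[X]) ^ f a).coeff k := by
  have hset : ∀ a, a ∈ s.filter (fun a => f a = k) ↔ P a ∧ f a = k := by simp [hP]
  rw [Nat.subtype_card _ hset, finsetSum_coeff, Finset.card_filter]
  simp only [coeff_X_pow, eq_comm]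

end MotzkinAvoiders

open MotzkinAvoiders in
theorem card_avoiders_eq_card_motzkin (n k : ℕ) :
    Nat.card {σ : Equiv.Perm (Fin n) // avoids321 σ ∧ avoidsMesh231 σ ∧ des σ = k} =
      Nat.card {p : List ℤ // IsMotzkin n p ∧ p.count 1 = k} := by
  classical
  have hperm := card_fiber_eq_coeff (Finset.univ.filter fun σ : Equiv.Perm (Fin n) => IsGood 0 σ)
    des (fun σ => avoids321 σ ∧ avoidsMesh231 σ) (by simp [isGood_zero_iff]) k
  rw [Finset.sum_filter] at hperm
  have hpath := card_fiber_eq_coeff (motzkinFrom n 0) (List.count 1) (IsMotzkin n)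
    (by simp [mem_motzkinFrom, isMotzkinFrom_zero_iff]) k
  rw [sum_motzkinFrom, ← goodPoly_eq_pathPoly, goodPoly] at hpath
  simp only [and_assoc] at hperm
  rw [hperm, hpath]
end
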